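/- Let p, p_i ∈ (1,∞) (i = 1,…,m) satisfy ∑_{i=1}^m 1/p_i = 1/p, and let φ, φ_i : ℝⁿ×(0,∞) → (0,∞) satisfy ∏_{i=1}^m φ_i(x,r)^{1/p_i} = φ(x,r)^{1/p}. Assume each φ_i ∈ 𝒢^dec with lim_{r→0} φ_i(x,r) = ∞ and lim_{r→∞} φ_i(x,r) = 0 for each x, and that there is C > 0 such that Cφ(x,r) ≥ φ(x,s) whenever 0 < r < s. Then the m-linear maximal operator 𝓜 is bounded from L^{(p_1,φ_1)}(ℝⁿ)×⋯×L^{(p_m,φ_m)}(ℝⁿ) to L^{(p,φ)}(ℝⁿ): there is C > 0 with ‖𝓜(f⃗)‖_{L^{(p,φ)}} ≤ C ∏_{i=1}^m ‖f_i‖_{L^{(p_i,φ_i)}}. -/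

import Mathlib

open MeasureTheory Metric ENNReal Filter

/-- The generalized Morrey norm of a real function. -/
noncomputable def morreyNorm (n : ℕ) (p : ℝ)
    (φ : EuclideanSpace ℝ (Fin n) → ℝ → ℝ) (f : EuclideanSpace ℝ (Fin n) → ℝ) : ℝ≥0∞ :=
  ⨆ (x : EuclideanSpace ℝ (Fin n)) (r : ℝ) (_ : 0 < r),
    ((∫⁻ y in ball x r, ENNReal.ofReal (|f y| ^ p)) /
      (ENNReal.ofReal (φ x r) * volume (ball x r))) ^ (1 / p)

/-- The generalized Morrey norm of an `ℝ≥0∞`-valued function. -/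
noncomputable def morreyNormE (n : ℕ) (p : ℝ)
    (φ : EuclideanSpace ℝ (Fin n) → ℝ → ℝ) (g : EuclideanSpace ℝ (Fin n) → ℝ≥0∞) : ℝ≥0∞ :=
  ⨆ (x : EuclideanSpace ℝ (Fin n)) (r : ℝ) (_ : 0 < r),
    ((∫⁻ y in ball x r, g y ^ p) /
      (ENNReal.ofReal (φ x r) * volume (ball x r))) ^ (1 / p)

/-- The `m`-linear maximal operator `𝓜(f⃗)(x) = sup_{B ∋ x} ∏ᵢ ⨍_B |fᵢ|`. -/
noncomputable def multiMaximal (n m : ℕ) (f : Fin m → EuclideanSpace ℝ (Fin n) → ℝ)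
    (x : EuclideanSpace ℝ (Fin n)) : ℝ≥0∞ :=
  ⨆ (z : EuclideanSpace ℝ (Fin n)) (r : ℝ) (_ : 0 < r) (_ : x ∈ ball z r),
    ∏ i, (∫⁻ y in ball z r, ENNReal.ofReal |f i y|) / volume (ball z r)

/-- `φ ∈ 𝒢^dec`. -/
def Gdec (n : ℕ) (φ : EuclideanSpace ℝ (Fin n) → ℝ → ℝ) : Prop :=
  ∃ C > (0 : ℝ), ∀ x (r s : ℝ), 0 < r → r < s →
    φ x s ≤ C * φ x r ∧ φ x r * r ^ (n : ℝ) ≤ C * (φ x s * s ^ (n : ℝ))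

noncomputable def hlM (n : ℕ) (R : ℝ) (g : EuclideanSpace ℝ (Fin n) → ℝ≥0∞)
    (x : EuclideanSpace ℝ (Fin n)) : ℝ≥0∞ :=
  ⨆ (z : EuclideanSpace ℝ (Fin n)) (s : ℝ) (_ : 0 < s) (_ : s ≤ R) (_ : x ∈ ball z s),
    (∫⁻ y in ball z s, g y) / volume (ball z s)

lemma lt_hlM_iff {n : ℕ} {R : ℝ} {g : EuclideanSpace ℝ (Fin n) → ℝ≥0∞}
    {x : EuclideanSpace ℝ (Fin n)} {t : ℝ≥0∞} :
    t < hlM n R g x ↔ ∃ z s, 0 < s ∧ s ≤ R ∧ x ∈ ball z s ∧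
      t < (∫⁻ y in ball z s, g y) / volume (ball z s) := by
  simp only [hlM, lt_iSup_iff, exists_prop]

lemma measurable_hlM {n : ℕ} {R : ℝ} {g : EuclideanSpace ℝ (Fin n) → ℝ≥0∞} :
    Measurable (hlM n R g) := by
  apply measurable_of_Ioi
  intro t
  apply IsOpen.measurableSet
  rw [Metric.isOpen_iff]
  intro x hx
  obtain ⟨z, s, h0, hR, hxz, ht⟩ := lt_hlM_iff.1 hx
  obtain ⟨e, he, hsub⟩ := Metric.isOpen_iff.1 isOpen_ball x hxz
  exact ⟨e, he, fun y hy => lt_hlM_iff.2 ⟨z, s, h0, hR, hsub hy, ht⟩⟩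

lemma vol_ball_mul (n : ℕ) (z w : EuclideanSpace ℝ (Fin n)) {c : ℝ} (hc : 0 < c) (s : ℝ) :
    volume (ball z (c * s)) = ENNReal.ofReal (c ^ n) * volume (ball w s) := by
  rw [Measure.addHaar_ball_mul_of_pos volume z hc, ← Measure.addHaar_ball_center volume w]
  simp

lemma weak_hlM (n : ℕ) (R : ℝ) (g : EuclideanSpace ℝ (Fin n) → ℝ≥0∞) (t : ℝ≥0∞) :
    t * volume {x | t < hlM n R g x} ≤ ENNReal.ofReal (6 ^ n) * ∫⁻ y, g y := by
  let T : Set (EuclideanSpace ℝ (Fin n) × ℝ) := {a | 0 < a.2 ∧ a.2 ≤ R ∧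
    t < (∫⁻ y in ball a.1 a.2, g y) / volume (ball a.1 a.2)}
  obtain ⟨u, huT, hdisj, hcov⟩ := Vitali.exists_disjoint_subfamily_covering_enlargement_closedBall
    T (fun a => a.1) (fun a => a.2) R (fun a ha => ha.2.1) 5 (by norm_num)
  have hcount : u.Countable := by
    refine hdisj.countable_of_nonempty_interior fun a ha => ?_
    exact (nonempty_ball.2 (huT ha).1).mono ball_subset_interior_closedBall
  have hsub : {x | t < hlM n R g x} ⊆ ⋃ b ∈ u, ball b.1 (6 * b.2) := by
    intro x hx
    obtain ⟨z, s, h0, hR, hxz, ht⟩ := lt_hlM_iff.1 hx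
    obtain ⟨b, hb, hsub⟩ := hcov (z, s) ⟨h0, hR, ht⟩
    refine Set.mem_biUnion hb ?_
    refine closedBall_subset_ball ?_ (hsub (ball_subset_closedBall hxz))
    have := (huT hb).1
    linarith
  have hd2 : u.PairwiseDisjoint fun a => ball a.1 a.2 :=
    hdisj.mono fun a => ball_subset_closedBall
  calc t * volume {x | t < hlM n R g x}
      ≤ t * ∑' b : u, volume (ball b.1.1 (6 * b.1.2)) := by
        gcongr
        exact (measure_mono hsub).trans (measure_biUnion_le _ hcount _)
    _ = ∑' b : u, ENNReal.ofReal (6 ^ n) * (t * volume (ball b.1.1 b.1.2)) := by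
        rw [← ENNReal.tsum_mul_left]
        congr 1; ext b
        rw [vol_ball_mul n b.1.1 b.1.1 (by norm_num)]
        ring
    _ ≤ ∑' b : u, ENNReal.ofReal (6 ^ n) * ∫⁻ y in ball b.1.1 b.1.2, g y := by
        gcongr with b
        exact ENNReal.mul_le_of_le_div (huT b.2).2.2.le
    _ = ENNReal.ofReal (6 ^ n) * ∫⁻ y in ⋃ b ∈ u, ball b.1 b.2, g y := by
        rw [ENNReal.tsum_mul_left, lintegral_biUnion hcount (fun _ _ => measurableSet_ball) hd2]
    _ ≤ _ := by
        gcongr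
        exact Measure.restrict_le_self

lemma weak2_hlM (n : ℕ) (R : ℝ) (g : EuclideanSpace ℝ (Fin n) → ℝ≥0∞)
    (t : ℝ≥0∞) :
    t * volume {x | t < hlM n R g x} ≤
      ENNReal.ofReal (2 * 6 ^ n) * ∫⁻ y, {y | t < 2 * g y}.indicator g y := by
  set g1 := {y | t < 2 * g y}.indicator g
  have hsub : {x | t < hlM n R g x} ⊆ {x | t / 2 < hlM n R g1 x} := by
    intro x hx
    obtain ⟨z, s, h0, hR, hxz, hlt⟩ := lt_hlM_iff.1 hx
    refine lt_hlM_iff.2 ⟨z, s, h0, hR, hxz, ?_⟩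
    have hv0 : volume (ball z s) ≠ 0 := (measure_ball_pos _ _ h0).ne'
    have hvt : volume (ball z s) ≠ ⊤ := measure_ball_lt_top.ne
    have h1 : (∫⁻ y in ball z s, g y) / volume (ball z s) ≤
        (∫⁻ y in ball z s, g1 y) / volume (ball z s) + t / 2 := by
      have : ∫⁻ y in ball z s, g y ≤ ∫⁻ y in ball z s, (g1 y + t / 2) := by
        apply lintegral_mono
        intro y
        by_cases hy : t < 2 * g y
        · simp [g1, Set.indicator, hy]
        · simp only [g1, Set.indicator, Set.mem_ofPred_eq, hy, if_false, zero_add]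
          rw [ENNReal.le_div_iff_mul_le (by simp) (by simp), mul_comm]
          exact not_lt.1 hy
      rw [lintegral_add_right _ measurable_const, lintegral_const,
        Measure.restrict_apply_univ] at this
      calc _ ≤ ((∫⁻ y in ball z s, g1 y) + t / 2 * volume (ball z s)) / volume (ball z s) := by
            gcongr
        _ = _ := by
            rw [ENNReal.add_div, ENNReal.mul_div_cancel_right hv0 hvt]
    by_contra hcon
    have := h1.trans (add_le_add_left (not_lt.1 hcon) (t/2))
    rw [ENNReal.add_halves] at this
    exact absurd hlt (not_lt.2 this)
  have := weak_hlM n R g1 (t / 2)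
  calc t * volume {x | t < hlM n R g x} ≤ t * volume {x | t / 2 < hlM n R g1 x} := by
        gcongr
    _ = 2 * (t / 2 * volume {x | t / 2 < hlM n R g1 x}) := by
        rw [← mul_assoc, ENNReal.mul_div_cancel (by simp) (by simp)]
    _ ≤ 2 * (ENNReal.ofReal (6 ^ n) * ∫⁻ y, g1 y) := by gcongr
    _ = _ := by
        rw [ENNReal.ofReal_mul (by norm_num)]
        simp [mul_assoc]

noncomputable def layK (a : ℝ) (h : ℝ≥0∞) : ℝ≥0∞ :=
  ∫⁻ t in Set.Ioi (0:ℝ), {t : ℝ | ENNReal.ofReal t < h}.indicator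
    (fun t => ENNReal.ofReal (t ^ (a - 1))) t

lemma layK_ofReal {a : ℝ} (ha : 0 < a) {b : ℝ} (hb : 0 ≤ b) :
    layK a (ENNReal.ofReal b) = ENNReal.ofReal (b ^ a / a) := by
  have hms : MeasurableSet {t : ℝ | ENNReal.ofReal t < ENNReal.ofReal b} :=
    measurableSet_lt (by fun_prop) (by fun_prop)
  have hset : {t : ℝ | ENNReal.ofReal t < ENNReal.ofReal b} ∩ Set.Ioi 0 = Set.Ioo 0 b := by
    ext t
    simp only [Set.mem_inter_iff, Set.mem_ofPred_eq, Set.mem_Ioi, Set.mem_Ioo]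
    constructor
    · rintro ⟨h1, h2⟩
      exact ⟨h2, (ENNReal.ofReal_lt_ofReal_iff_of_nonneg h2.le).1 h1⟩
    · rintro ⟨h1, h2⟩
      exact ⟨(ENNReal.ofReal_lt_ofReal_iff_of_nonneg h1.le).2 h2, h1⟩
  have hint : IntervalIntegrable (fun t : ℝ => t ^ (a - 1)) volume 0 b :=
    intervalIntegral.intervalIntegrable_rpow' (by linarith)
  rw [layK, lintegral_indicator hms, Measure.restrict_restrict hms, hset,
    ← Measure.restrict_congr_set Ioo_ae_eq_Ioc.symm, ← ofReal_integral_eq_lintegral_ofReal]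
  · rw [← intervalIntegral.integral_of_le hb, integral_rpow (Or.inl (by linarith))]
    congr 1
    simp [Real.zero_rpow ha.ne']
  · exact (intervalIntegrable_iff_integrableOn_Ioc_of_le hb).1 hint
  · filter_upwards [ae_restrict_mem measurableSet_Ioc] with t ht
    exact Real.rpow_nonneg ht.1.le _

lemma layK_mono (a : ℝ) : Monotone (layK a) := by
  intro h k hk
  apply lintegral_mono
  intro t
  apply Set.indicator_le_indicator_of_subset (fun s hs => lt_of_lt_of_le hs hk)
  simp

lemma rpow_le_layK {a : ℝ} (ha : 0 < a) (h : ℝ≥0∞) : h ^ a ≤ ENNReal.ofReal a * layK a h := by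
  have key : ∀ b : ℝ, 0 ≤ b →
      ENNReal.ofReal a * layK a (ENNReal.ofReal b) = ENNReal.ofReal b ^ a := by
    intro b hb
    rw [layK_ofReal ha hb, ← ENNReal.ofReal_mul ha.le, ENNReal.ofReal_rpow_of_nonneg hb ha.le]
    congr 1
    field_simp
  by_cases hh : h = ⊤
  · subst hh
    rw [ENNReal.top_rpow_of_pos ha]
    rw [top_le_iff]
    apply ENNReal.eq_top_of_forall_nnreal_le
    intro r
    have h1 := key ((r:ℝ) ^ (1/a)) (by positivity)
    rw [ENNReal.ofReal_rpow_of_nonneg (by positivity) ha.le, ← Real.rpow_mul (by positivity),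
      one_div_mul_cancel ha.ne', Real.rpow_one, ENNReal.ofReal_coe_nnreal] at h1
    rw [← h1]
    gcongr
    exact layK_mono a le_top
  · rw [← ENNReal.ofReal_toReal hh]
    exact (key _ ENNReal.toReal_nonneg).ge

lemma strong_hlM (n : ℕ) (q : ℝ) (hq : 1 < q) : ∃ A : ℝ≥0∞, A ≠ ⊤ ∧
    ∀ (R : ℝ) (g : EuclideanSpace ℝ (Fin n) → ℝ≥0∞), Measurable g → (∀ x, g x ≠ ⊤) →
      ∫⁻ x, hlM n R g x ^ q ≤ A * ∫⁻ x, g x ^ q := by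
  refine ⟨ENNReal.ofReal q * (ENNReal.ofReal (2 * 6 ^ n) * ENNReal.ofReal (2 ^ (q-1) / (q-1))),
    ENNReal.mul_ne_top (by simp) (ENNReal.mul_ne_top ENNReal.ofReal_ne_top ENNReal.ofReal_ne_top), ?_⟩
  intro R g hg hgt
  have hq0 : 0 < q := by linarith
  have hMm : Measurable (hlM n R g) := measurable_hlM
  have hstep : ∀ t ∈ Set.Ioi (0:ℝ),
      ENNReal.ofReal (t ^ (q - 1)) * volume {x | ENNReal.ofReal t < hlM n R g x} ≤
      ENNReal.ofReal (2 * 6 ^ n) * ∫⁻ y, {y | ENNReal.ofReal t < 2 * g y}.indicator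
        (fun y => g y * ENNReal.ofReal (t ^ (q - 1 - 1))) y := by
    intro t ht
    have ht0 : 0 < t := ht
    have h1 : t ^ (q - 1) = t ^ (q - 1 - 1) * t := by
      rw [Real.rpow_sub_one ht0.ne' (q-1)]; field_simp
    have := weak2_hlM n R g (ENNReal.ofReal t)
    have hms : MeasurableSet {y | ENNReal.ofReal t < 2 * g y} :=
      measurableSet_lt (by fun_prop) (by fun_prop)
    rw [lintegral_indicator hms, lintegral_mul_const _ hg]
    rw [lintegral_indicator hms] at this
    rw [h1, ENNReal.ofReal_mul (by positivity)]
    calc _ = ENNReal.ofReal (t ^ (q - 1 - 1)) *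
          (ENNReal.ofReal t * volume {x | ENNReal.ofReal t < hlM n R g x}) := by ring
      _ ≤ ENNReal.ofReal (t ^ (q - 1 - 1)) * (ENNReal.ofReal (2 * 6 ^ n) *
          ∫⁻ y in {y | ENNReal.ofReal t < 2 * g y}, g y) := by gcongr
      _ = _ := by ring
  calc ∫⁻ x, hlM n R g x ^ q ≤ ∫⁻ x, ENNReal.ofReal q * layK q (hlM n R g x) :=
        lintegral_mono fun x => rpow_le_layK hq0 _
    _ = ENNReal.ofReal q * ∫⁻ x, layK q (hlM n R g x) := by
        rw [lintegral_const_mul' _ _ (by simp)]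
    _ = ENNReal.ofReal q * ∫⁻ t in Set.Ioi (0:ℝ), ∫⁻ x,
          {x | ENNReal.ofReal t < hlM n R g x}.indicator
            (fun _ => ENNReal.ofReal (t ^ (q - 1))) x := by
        congr 1
        unfold layK
        rw [lintegral_lintegral_swap]
        · rfl
        · apply Measurable.aemeasurable
          have : MeasurableSet {z : EuclideanSpace ℝ (Fin n) × ℝ |
              ENNReal.ofReal z.2 < hlM n R g z.1} :=
            measurableSet_lt (by fun_prop) (by fun_prop)
          exact Measurable.indicator (f := fun z : EuclideanSpace ℝ (Fin n) × ℝ =>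
            ENNReal.ofReal (z.2 ^ (q - 1))) (by fun_prop) this
    _ = ENNReal.ofReal q * ∫⁻ t in Set.Ioi (0:ℝ), ENNReal.ofReal (t ^ (q - 1)) *
          volume {x | ENNReal.ofReal t < hlM n R g x} := by
        congr 1
        apply lintegral_congr
        intro t
        rw [lintegral_indicator_const (measurableSet_lt (by fun_prop) hMm)]
    _ ≤ ENNReal.ofReal q * ∫⁻ t in Set.Ioi (0:ℝ), ENNReal.ofReal (2 * 6 ^ n) *
          ∫⁻ y, {y | ENNReal.ofReal t < 2 * g y}.indicator
            (fun y => g y * ENNReal.ofReal (t ^ (q - 1 - 1))) y := by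
        gcongr ENNReal.ofReal q * ?_
        exact setLIntegral_mono' measurableSet_Ioi hstep
    _ = ENNReal.ofReal q * (ENNReal.ofReal (2 * 6 ^ n) * ∫⁻ y, ∫⁻ t in Set.Ioi (0:ℝ),
          {y | ENNReal.ofReal t < 2 * g y}.indicator
            (fun y => g y * ENNReal.ofReal (t ^ (q - 1 - 1))) y) := by
        rw [lintegral_const_mul' _ _ ENNReal.ofReal_ne_top, lintegral_lintegral_swap]
        apply Measurable.aemeasurable
        have : MeasurableSet {z : ℝ × EuclideanSpace ℝ (Fin n) |
            ENNReal.ofReal z.1 < 2 * g z.2} :=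
          measurableSet_lt (by fun_prop) (by fun_prop)
        exact Measurable.indicator (f := fun z : ℝ × EuclideanSpace ℝ (Fin n) =>
            g z.2 * ENNReal.ofReal (z.1 ^ (q - 1 - 1))) (by fun_prop) this
    _ = ENNReal.ofReal q * (ENNReal.ofReal (2 * 6 ^ n) * ∫⁻ y,
          g y * layK (q - 1) (2 * g y)) := by
        congr 2
        apply lintegral_congr
        intro y
        rw [layK, ← lintegral_const_mul' _ _ (hgt y)]
        apply lintegral_congr
        intro t
        by_cases h : ENNReal.ofReal t < 2 * g y <;> simp [Set.indicator, h]
    _ = ENNReal.ofReal q * (ENNReal.ofReal (2 * 6 ^ n) * ∫⁻ y,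
          ENNReal.ofReal (2 ^ (q-1) / (q-1)) * g y ^ q) := by
        congr 2
        apply lintegral_congr
        intro y
        obtain ⟨b, hb, hby⟩ : ∃ b : ℝ, 0 ≤ b ∧ g y = ENNReal.ofReal b :=
          ⟨(g y).toReal, ENNReal.toReal_nonneg, (ENNReal.ofReal_toReal (hgt y)).symm⟩
        have h2 : 2 * g y = ENNReal.ofReal (2 * b) := by
          rw [ENNReal.ofReal_mul (by norm_num), hby]; simp
        have hq1 : 0 < q - 1 := by linarith
        rw [h2, layK_ofReal hq1 (by positivity), hby,
          ENNReal.ofReal_rpow_of_nonneg hb hq0.le, ← ENNReal.ofReal_mul hb,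
          ← ENNReal.ofReal_mul (by positivity)]
        congr 1
        rw [Real.mul_rpow (by norm_num) hb]
        have : b ^ q = b ^ (q - 1) * b := by
          rcases hb.eq_or_lt with rfl | hb
          · simp [Real.zero_rpow hq0.ne']
          · rw [Real.rpow_sub_one hb.ne']; field_simp
        rw [this]; ring
    _ = _ := by
        rw [lintegral_const_mul' _ _ (by simp)]; ring

lemma vol_ne (n : ℕ) (a : EuclideanSpace ℝ (Fin n)) {r : ℝ} (hr : 0 < r) :
    volume (ball a r) ≠ 0 ∧ volume (ball a r) ≠ ⊤ :=
  ⟨(measure_ball_pos _ _ hr).ne', measure_ball_lt_top.ne⟩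

lemma morrey_le (n : ℕ) {q : ℝ} (hq : 0 < q) (φ : EuclideanSpace ℝ (Fin n) → ℝ → ℝ)
    (f : EuclideanSpace ℝ (Fin n) → ℝ) (a : EuclideanSpace ℝ (Fin n)) {r : ℝ} (hr : 0 < r)
    (hφ : 0 < φ a r) :
    ∫⁻ y in ball a r, ENNReal.ofReal |f y| ^ q ≤
      morreyNorm n q φ f ^ q * (ENNReal.ofReal (φ a r) * volume (ball a r)) := by
  obtain ⟨h0, h1⟩ := vol_ne n a hr
  have h : ((∫⁻ y in ball a r, ENNReal.ofReal (|f y| ^ q)) /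
      (ENNReal.ofReal (φ a r) * volume (ball a r))) ^ (1 / q) ≤ morreyNorm n q φ f :=
    le_iSup_of_le a (le_iSup_of_le r (le_iSup_of_le hr le_rfl))
  have h2 := ENNReal.rpow_le_rpow h hq.le
  rw [← ENNReal.rpow_mul, one_div_mul_cancel hq.ne', ENNReal.rpow_one] at h2
  rw [ENNReal.div_le_iff (mul_ne_zero (by simpa using hφ) h0)
    (ENNReal.mul_ne_top (by simp) h1)] at h2
  refine le_trans (le_of_eq ?_) h2
  apply lintegral_congr
  intro y
  rw [ENNReal.ofReal_rpow_of_nonneg (abs_nonneg _) hq.le]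

lemma avg_le (n : ℕ) {q : ℝ} (hq : 1 < q) (φ : EuclideanSpace ℝ (Fin n) → ℝ → ℝ)
    (f : EuclideanSpace ℝ (Fin n) → ℝ) (hf : Measurable f)
    (a : EuclideanSpace ℝ (Fin n)) {r : ℝ} (hr : 0 < r)
    (hφ : 0 < φ a r) :
    (∫⁻ y in ball a r, ENNReal.ofReal |f y|) / volume (ball a r) ≤
      morreyNorm n q φ f * ENNReal.ofReal (φ a r) ^ (1 / q) := by
  have hq0 : 0 < q := by linarith
  obtain ⟨h0, h1⟩ := vol_ne n a hr
  have hc := Real.HolderConjugate.conjExponent hq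
  have hH := ENNReal.lintegral_mul_le_Lp_mul_Lq (volume.restrict (ball a r)) hc
    (f := fun y => ENNReal.ofReal |f y|) (g := fun _ => 1) (by fun_prop) (by fun_prop)
  simp only [Pi.mul_apply, mul_one, ENNReal.one_rpow, lintegral_const,
    Measure.restrict_apply_univ, one_mul] at hH
  apply ENNReal.div_le_of_le_mul
  refine hH.trans ?_
  have h2 := ENNReal.rpow_le_rpow (morrey_le n hq0 φ f a hr hφ)
    (show 0 ≤ 1 / q by positivity)
  rw [ENNReal.mul_rpow_of_nonneg _ _ (by positivity), ENNReal.mul_rpow_of_nonneg _ _ (by positivity),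
    ← ENNReal.rpow_mul, mul_one_div_cancel hq0.ne', ENNReal.rpow_one] at h2
  have h3 : volume (ball a r) ^ (1 / q) * volume (ball a r) ^ (1 / q.conjExponent)
      = volume (ball a r) := by
    rw [← ENNReal.rpow_add _ _ h0 h1, one_div, one_div, hc.inv_add_inv_eq_one, ENNReal.rpow_one]
  calc _ ≤ (morreyNorm n q φ f * (ENNReal.ofReal (φ a r) ^ (1 / q) * volume (ball a r) ^ (1 / q)))
        * volume (ball a r) ^ (1 / q.conjExponent) := by gcongr
    _ = morreyNorm n q φ f * ENNReal.ofReal (φ a r) ^ (1 / q) * (volume (ball a r) ^ (1 / q) *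
        volume (ball a r) ^ (1 / q.conjExponent)) := by ring
    _ = _ := by rw [h3]

lemma prod_rpow_const {ι : Type*} (s : Finset ι) (e : ι → ℝ) (x : ℝ≥0∞) (h0 : x ≠ 0) (h1 : x ≠ ⊤) :
    ∏ i ∈ s, x ^ e i = x ^ ∑ i ∈ s, e i := by
  classical
  induction s using Finset.induction_on with
  | empty => simp
  | insert i s hi ih => rw [Finset.prod_insert hi, Finset.sum_insert hi, ih, ENNReal.rpow_add _ _ h0 h1]

/-- boundedness of the `m`-linear maximal operator `𝓜` from
`L^{(p₁,φ₁)} × ⋯ × L^{(p_m,φ_m)}` to `L^{(p,φ)}`. -/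
theorem multiMaximal_bounded (n m : ℕ) (p : ℝ) (pp : Fin m → ℝ)
    (hp : 1 < p) (hpp : ∀ i, 1 < pp i)
    (hsum : ∑ i, 1 / pp i = 1 / p)
    (φ : EuclideanSpace ℝ (Fin n) → ℝ → ℝ)
    (φi : Fin m → EuclideanSpace ℝ (Fin n) → ℝ → ℝ)
    (hφpos : ∀ x r, 0 < r → 0 < φ x r)
    (hφipos : ∀ i x r, 0 < r → 0 < φi i x r)
    (hprod : ∀ x (r : ℝ), 0 < r → ∏ i, φi i x r ^ (1 / pp i) = φ x r ^ (1 / p))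
    (hφidec : ∀ i, Gdec n (φi i))
    (hφi0 : ∀ i x, Tendsto (fun r => φi i x r) (nhdsWithin 0 (Set.Ioi 0)) atTop)
    (hφiInf : ∀ i x, Tendsto (fun r => φi i x r) atTop (nhds 0))
    (C : ℝ) (hC : 0 < C)
    (hφmono : ∀ x (r s : ℝ), 0 < r → r < s → φ x s ≤ C * φ x r) :
    ∃ C' : ℝ≥0∞, C' ≠ ⊤ ∧
      ∀ f : Fin m → EuclideanSpace ℝ (Fin n) → ℝ,
        (∀ i, Measurable (f i)) → (∀ i, morreyNorm n (pp i) (φi i) (f i) ≠ ⊤) →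
        morreyNormE n p φ (multiMaximal n m f) ≤ C' * ∏ i, morreyNorm n (pp i) (φi i) (f i) := by
  have hp0 : 0 < p := by linarith
  have hpp0 : ∀ i, 0 < pp i := fun i => by linarith [hpp i]
  choose A hA hstrong using fun i => strong_hlM n (pp i) (hpp i)
  set T : ℝ≥0∞ := ENNReal.ofReal (3 ^ n) with hT
  have hTt : T ≠ ⊤ := ENNReal.ofReal_ne_top
  have hT0 : T ≠ 0 := by rw [hT]; simp
  set D : ℝ≥0∞ := ∏ i, A i ^ (p / pp i) with hD
  have hDt : D ≠ ⊤ := ENNReal.prod_ne_top fun i _ =>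
    ENNReal.rpow_ne_top_of_nonneg (div_pos hp0 (hpp0 i)).le (hA i)
  set c : ℝ≥0∞ := ENNReal.ofReal C with hc
  have hct : c ≠ ⊤ := ENNReal.ofReal_ne_top
  refine ⟨(D * T * c + (T ^ m) ^ p * c) ^ (1 / p), ?_, ?_⟩
  · apply ENNReal.rpow_ne_top_of_nonneg (by positivity)
    exact ENNReal.add_ne_top.2 ⟨ENNReal.mul_ne_top (ENNReal.mul_ne_top hDt hTt) hct,
      ENNReal.mul_ne_top (ENNReal.rpow_ne_top_of_nonneg hp0.le (ENNReal.pow_ne_top hTt)) hct⟩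
  intro f hf _
  set N : Fin m → ℝ≥0∞ := fun i => morreyNorm n (pp i) (φi i) (f i) with hN
  -- products of the weights
  have hΦ1 : ∀ x (r : ℝ), 0 < r →
      ∏ i, ENNReal.ofReal (φi i x r) ^ (1 / pp i) = ENNReal.ofReal (φ x r) ^ (1 / p) := by
    intro x r hr
    rw [ENNReal.ofReal_rpow_of_pos (hφpos x r hr), ← hprod x r hr,
      ENNReal.ofReal_prod_of_nonneg fun i _ => Real.rpow_nonneg (hφipos i x r hr).le _]
    exact Finset.prod_congr rfl fun i _ => ENNReal.ofReal_rpow_of_pos (hφipos i x r hr)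
  have hΦ2 : ∀ x (r : ℝ), 0 < r →
      ∏ i, ENNReal.ofReal (φi i x r) ^ (p / pp i) = ENNReal.ofReal (φ x r) := by
    intro x r hr
    have h1 : ∀ i, ENNReal.ofReal (φi i x r) ^ (p / pp i) =
        (ENNReal.ofReal (φi i x r) ^ (1 / pp i)) ^ p := by
      intro i
      rw [← ENNReal.rpow_mul]; congr 1; ring
    simp_rw [h1]
    rw [ENNReal.prod_rpow_of_nonneg hp0.le, hΦ1 x r hr, ← ENNReal.rpow_mul,
      one_div_mul_cancel hp0.ne', ENNReal.rpow_one]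
  have hΦm : ∀ x (r s : ℝ), 0 < r → r < s →
      ENNReal.ofReal (φ x s) ≤ c * ENNReal.ofReal (φ x r) := by
    intro x r s hr hs
    rw [hc, ← ENNReal.ofReal_mul hC.le]
    exact ENNReal.ofReal_le_ofReal (hφmono x r s hr hs)
  have hsum1 : ∑ i, p / pp i = 1 := by
    have : ∀ i, p / pp i = p * (1 / pp i) := fun i => by ring
    simp_rw [this]
    rw [← Finset.mul_sum, hsum, mul_one_div_cancel hp0.ne']
  unfold morreyNormE
  refine iSup_le fun a => iSup_le fun r => iSup_le fun hr => ?_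
  obtain ⟨hV0, hVt⟩ := vol_ne n a hr
  set V := volume (ball a r) with hV
  set Φ := ENNReal.ofReal (φ a r) with hΦ
  have hΦ0 : Φ ≠ 0 := by rw [hΦ]; simpa using hφpos a r hr
  have hΦt : Φ ≠ ⊤ := ENNReal.ofReal_ne_top
  set g : Fin m → EuclideanSpace ℝ (Fin n) → ℝ≥0∞ := fun i =>
    (ball a (3 * r)).indicator (fun y => ENNReal.ofReal |f i y|) with hg
  have hgm : ∀ i, Measurable (g i) := fun i =>
    Measurable.indicator (by have := hf i; fun_prop) measurableSet_ball
  have hgt : ∀ i x, g i x ≠ ⊤ := by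
    intro i x
    simp only [hg, Set.indicator]
    split_ifs <;> simp
  set K : ℝ≥0∞ := T ^ m * (c * Φ) ^ (1 / p) * ∏ i, N i with hK
  -- pointwise bound
  have hpt : ∀ x ∈ ball a r, multiMaximal n m f x ^ p ≤ (∏ i, hlM n r (g i) x) ^ p + K ^ p := by
    intro x hx
    have hmax : multiMaximal n m f x ≤ max (∏ i, hlM n r (g i) x) K := by
      unfold multiMaximal
      refine iSup_le fun z => iSup_le fun s => iSup_le fun hs => iSup_le fun hxz => ?_
      have hxa : dist x a < r := hx
      have hxz' : dist x z < s := hxz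
      rcases le_or_gt s r with hsr | hsr
      · refine le_max_of_le_left (Finset.prod_le_prod' fun i _ => ?_)
        have hsub : ball z s ⊆ ball a (3 * r) := by
          intro y hy
          have hy' : dist y z < s := hy
          have h1 := dist_triangle y z a
          have h2 := dist_triangle z x a
          rw [dist_comm z x] at h2
          rw [mem_ball]; linarith
        have heq : ∫⁻ y in ball z s, ENNReal.ofReal |f i y| = ∫⁻ y in ball z s, g i y := by
          apply setLIntegral_congr_fun measurableSet_ball
          intro y hy
          simp only [hg]
          rw [Set.indicator_of_mem (hsub hy)]
        rw [heq]
        exact le_iSup_of_le z (le_iSup_of_le s (le_iSup_of_le hs (le_iSup_of_le hsr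
          (le_iSup_of_le hxz le_rfl))))
      · refine le_max_of_le_right ?_
        have hs3 : 0 < 3 * s := by linarith
        have hsub : ball z s ⊆ ball a (3 * s) := by
          intro y hy
          have hy' : dist y z < s := hy
          have h1 := dist_triangle y z a
          have h2 := dist_triangle z x a
          rw [dist_comm z x] at h2
          rw [mem_ball]; linarith
        have hvol := vol_ball_mul n a z (show (0:ℝ) < 3 by norm_num) s
        have hterm : ∀ i, (∫⁻ y in ball z s, ENNReal.ofReal |f i y|) / volume (ball z s) ≤
            T * (N i * ENNReal.ofReal (φi i a (3 * s)) ^ (1 / pp i)) := by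
          intro i
          calc _ ≤ (∫⁻ y in ball a (3 * s), ENNReal.ofReal |f i y|) / volume (ball z s) := by
                gcongr
            _ = T * ((∫⁻ y in ball a (3 * s), ENNReal.ofReal |f i y|) /
                  volume (ball a (3 * s))) := by
                rw [hvol, ← mul_div_assoc, ENNReal.mul_div_mul_left _ _ hT0 hTt]
            _ ≤ _ := by
                gcongr
                exact avg_le n (hpp i) (φi i) (f i) (hf i) a hs3 (hφipos i a _ hs3)
        calc _ ≤ ∏ i, T * (N i * ENNReal.ofReal (φi i a (3 * s)) ^ (1 / pp i)) :=
              Finset.prod_le_prod' fun i _ => hterm i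
          _ = T ^ m * ((∏ i, N i) * ENNReal.ofReal (φ a (3 * s)) ^ (1 / p)) := by
              rw [Finset.prod_mul_distrib, Finset.prod_mul_distrib, hΦ1 a _ hs3]
              simp
          _ ≤ T ^ m * ((∏ i, N i) * (c * Φ) ^ (1 / p)) := by
              gcongr
              exact hΦm a r (3 * s) hr (by linarith)
          _ = K := by rw [hK]; ring
    rcases le_max_iff.1 hmax with h | h
    · exact (ENNReal.rpow_le_rpow h hp0.le).trans le_self_add
    · exact (ENNReal.rpow_le_rpow h hp0.le).trans le_add_self
  -- local part
  have hloc : ∫⁻ x in ball a r, (∏ i, hlM n r (g i) x) ^ p ≤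
      D * T * c * ((∏ i, N i) ^ p * (Φ * V)) := by
    have hr3 : 0 < 3 * r := by linarith
    obtain ⟨hW0, hWt⟩ := vol_ne n a hr3
    have hW : volume (ball a (3 * r)) = T * V := vol_ball_mul n a a (by norm_num) r
    have hgi : ∀ i, ∫⁻ x, hlM n r (g i) x ^ pp i ≤ A i * (N i ^ pp i *
        (ENNReal.ofReal (φi i a (3 * r)) * volume (ball a (3 * r)))) := by
      intro i
      refine (hstrong i r (g i) (hgm i) (hgt i)).trans ?_
      gcongr
      refine le_trans (le_of_eq ?_)
        (morrey_le n (hpp0 i) (φi i) (f i) a hr3 (hφipos i a _ hr3))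
      rw [← lintegral_indicator measurableSet_ball]
      apply lintegral_congr
      intro x
      by_cases hx : x ∈ ball a (3 * r)
      · simp only [hg, Set.indicator_of_mem hx]
      · simp only [hg, Set.indicator_of_notMem hx, ENNReal.zero_rpow_of_pos (hpp0 i)]
    calc _ ≤ ∫⁻ x, (∏ i, hlM n r (g i) x) ^ p := setLIntegral_le_lintegral _ _
      _ = ∫⁻ x, ∏ i, (hlM n r (g i) x ^ pp i) ^ (p / pp i) := by
          apply lintegral_congr
          intro x
          rw [← ENNReal.prod_rpow_of_nonneg hp0.le]
          refine Finset.prod_congr rfl fun i _ => ?_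
          rw [← ENNReal.rpow_mul, mul_div_cancel₀ _ (hpp0 i).ne']
      _ ≤ ∏ i, (∫⁻ x, hlM n r (g i) x ^ pp i) ^ (p / pp i) :=
          ENNReal.lintegral_prod_norm_pow_le Finset.univ
            (fun i _ => (measurable_hlM.pow_const _).aemeasurable) hsum1
            (fun i _ => (div_pos hp0 (hpp0 i)).le)
      _ ≤ ∏ i, (A i * (N i ^ pp i *
            (ENNReal.ofReal (φi i a (3 * r)) * volume (ball a (3 * r))))) ^ (p / pp i) :=
          Finset.prod_le_prod' fun i _ =>
            ENNReal.rpow_le_rpow (hgi i) (div_pos hp0 (hpp0 i)).le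
      _ = ∏ i, (A i ^ (p / pp i) * (N i ^ p * (ENNReal.ofReal (φi i a (3 * r)) ^ (p / pp i) *
            volume (ball a (3 * r)) ^ (p / pp i)))) := by
          refine Finset.prod_congr rfl fun i _ => ?_
          have := (div_pos hp0 (hpp0 i)).le
          rw [ENNReal.mul_rpow_of_nonneg _ _ this, ENNReal.mul_rpow_of_nonneg _ _ this,
            ENNReal.mul_rpow_of_nonneg _ _ this, ← ENNReal.rpow_mul,
            mul_div_cancel₀ _ (hpp0 i).ne']
      _ = D * ((∏ i, N i) ^ p * (ENNReal.ofReal (φ a (3 * r)) * (T * V))) := by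
          rw [Finset.prod_mul_distrib, Finset.prod_mul_distrib, Finset.prod_mul_distrib,
            prod_rpow_const _ _ _ hW0 hWt, hsum1, ENNReal.rpow_one, hΦ2 a _ hr3, hW,
            ENNReal.prod_rpow_of_nonneg hp0.le]
      _ ≤ D * ((∏ i, N i) ^ p * ((c * Φ) * (T * V))) := by
          gcongr
          exact hΦm a r (3 * r) hr (by linarith)
      _ = _ := by ring
  have hKp : K ^ p = (T ^ m) ^ p * c * ((∏ i, N i) ^ p * Φ) := by
    rw [hK, ENNReal.mul_rpow_of_nonneg _ _ hp0.le, ENNReal.mul_rpow_of_nonneg _ _ hp0.le,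
      ← ENNReal.rpow_mul, one_div_mul_cancel hp0.ne', ENNReal.rpow_one]
    ring
  have hmain : ∫⁻ x in ball a r, multiMaximal n m f x ^ p ≤
      ((D * T * c + (T ^ m) ^ p * c) * (∏ i, N i) ^ p) * (Φ * V) := by
    calc _ ≤ ∫⁻ x in ball a r, ((∏ i, hlM n r (g i) x) ^ p + K ^ p) :=
          setLIntegral_mono' measurableSet_ball hpt
      _ = (∫⁻ x in ball a r, (∏ i, hlM n r (g i) x) ^ p) + K ^ p * V := by
          rw [lintegral_add_right _ measurable_const, lintegral_const,
            Measure.restrict_apply_univ]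
      _ ≤ D * T * c * ((∏ i, N i) ^ p * (Φ * V)) +
            (T ^ m) ^ p * c * ((∏ i, N i) ^ p * Φ) * V := by
          rw [hKp]
          gcongr
      _ = _ := by ring
  have hdiv := ENNReal.div_le_of_le_mul hmain
  calc _ ≤ ((D * T * c + (T ^ m) ^ p * c) * (∏ i, N i) ^ p) ^ (1 / p) :=
        ENNReal.rpow_le_rpow hdiv (by positivity)
    _ = _ := by
        rw [ENNReal.mul_rpow_of_nonneg _ _ (by positivity), ← ENNReal.rpow_mul,
          mul_one_div_cancel hp0.ne', ENNReal.rpow_one]
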